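/- Suppose the support of the unique stationary measure m_{τ,ε} is the whole circle ℝ/ℤ. Then the random dynamics is mixing in the following sense: for every bounded Borel measurable f : ℝ/ℤ → ℝ and every initial point x₀ ∈ ℝ/ℤ, the expectation ∫_Ω f(φ(n,ω)(x₀)) dP(ω) converges, as n → +∞, to ∫_{ℝ/ℤ} f dm_{τ,ε}. -/

import Mathlib

open MeasureTheory Real Filter Set Function

noncomputable section

lemma sin2_periodic : Function.Periodic (fun x : ℝ => Real.sin (2 * π * x)) 1 := by
  intro x
  simp only [mul_add, mul_one]
  exact Real.sin_add_two_pi _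

/-- `sin (2πx)` viewed as a function on the circle `ℝ/ℤ`. -/
def sinA : AddCircle (1:ℝ) → ℝ := sin2_periodic.lift

/-- The noisy Arnol'd circle map `F_w(x) = x + τ + σ w − ε sin (2πx)  (mod 1)`. -/
def Fmap (τ ε σ w : ℝ) : AddCircle (1:ℝ) → AddCircle (1:ℝ) :=
  fun x => x + (↑(τ + σ * w - ε * sinA x) : AddCircle (1:ℝ))

/-- The uniform probability measure on `I = [−1/2, 1/2]`. -/
def nuI : Measure ℝ := volume.restrict (Icc (-(1/2) : ℝ) (1/2))

/-- A Borel probability measure `m` on the circle is stationary for the noisy circle-map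
family when `∫_I (F_w)_* m dν(w) = m`. -/
def IsStationaryNoisy (τ ε σ : ℝ) (m : Measure (AddCircle (1:ℝ))) : Prop :=
  nuI.bind (fun w => m.map (Fmap τ ε σ w)) = m

/-- The topological support of a measure on the circle. -/
def measSupport (m : Measure (AddCircle (1:ℝ))) : Set (AddCircle (1:ℝ)) :=
  {x | ∀ U : Set (AddCircle (1:ℝ)), IsOpen U → x ∈ U → 0 < m U}

/-- The forward random iterates `φ(0,ω) = id`, `φ(n,ω) = F_{ω_{n−1}} ∘ ⋯ ∘ F_{ω_0}`. -/
def phiN (τ ε σ : ℝ) (ω : ℤ → ℝ) : ℕ → AddCircle (1:ℝ) → AddCircle (1:ℝ)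
  | 0 => id
  | n + 1 => Fmap τ ε σ (ω n) ∘ phiN τ ε σ ω n

/-- `P` is the two-sided infinite product measure `ν^⊗ℤ` on `Ω = I^ℤ`, characterized by
its finite-dimensional marginals. -/
def IsProductNuZ (P : Measure (ℤ → ℝ)) : Prop :=
  IsProbabilityMeasure P ∧
    ∀ s : Finset ℤ, P.map (fun ω (i : s) => ω i) = Measure.pi (fun _ : s => nuI)

instance nuI.instIsProbabilityMeasure : IsProbabilityMeasure nuI :=
  ⟨by simp [nuI]; norm_num⟩

lemma continuous_sinA : Continuous sinA := by
  rw [(QuotientAddGroup.isQuotientMap_mk (N := AddSubgroup.zmultiples (1:ℝ))).continuous_iff]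
  have h : sinA ∘ (QuotientAddGroup.mk : ℝ → AddCircle (1:ℝ)) =
      fun x : ℝ => Real.sin (2 * π * x) := by
    funext x
    exact sin2_periodic.lift_coe x
  exact h ▸ by fun_prop

/-- The noiseless circle map `x ↦ x + τ − ε sin (2πx)  (mod 1)`. -/
def arnoldMap (τ ε : ℝ) (x : AddCircle (1:ℝ)) : AddCircle (1:ℝ) :=
  x + ((τ - ε * sinA x : ℝ) : AddCircle (1:ℝ))

lemma Fmap_eq_arnoldMap_add (τ ε σ w : ℝ) (x : AddCircle (1:ℝ)) :
    Fmap τ ε σ w x = arnoldMap τ ε x + ((σ * w : ℝ) : AddCircle (1:ℝ)) := by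
  simp only [Fmap, arnoldMap]
  rw [add_assoc, ← AddCircle.coe_add]
  congr 2
  ring

lemma continuous_coe_addCircle : Continuous (fun t : ℝ => (t : AddCircle (1:ℝ))) :=
  AddCircle.continuous_mk' 1

lemma continuous_arnoldMap (τ ε : ℝ) : Continuous (arnoldMap τ ε) := by
  have := continuous_sinA
  exact continuous_id.add (continuous_coe_addCircle.comp (by fun_prop))

lemma continuous_uncurry_Fmap (τ ε σ : ℝ) :
    Continuous fun p : AddCircle (1:ℝ) × ℝ => Fmap τ ε σ p.2 p.1 := by
  have := continuous_sinA
  exact continuous_fst.add (continuous_coe_addCircle.comp (by fun_prop))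

lemma surjective_arnoldMap (τ ε : ℝ) : Surjective (arnoldMap τ ε) := by
  have hcont : Continuous fun a : ℝ => a + τ - ε * Real.sin (2 * π * a) := by fun_prop
  have hbd : ∀ a : ℝ, |τ - ε * Real.sin (2 * π * a)| ≤ |τ| + |ε| := fun a => by
    refine (abs_sub _ _).trans ?_
    rw [abs_mul]
    nlinarith [Real.abs_sin_le_one (2 * π * a), abs_nonneg ε]
  have hsurj : Surjective fun a : ℝ => a + τ - ε * Real.sin (2 * π * a) := by
    refine hcont.surjective ?_ ?_
    · refine tendsto_atTop_mono (fun a => ?_)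
        (tendsto_atTop_add_const_right atTop (-(|τ| + |ε|)) tendsto_id)
      have := (abs_le.mp (hbd a)).1
      simp only [id]
      linarith
    · refine tendsto_atBot_mono (fun a => ?_)
        (tendsto_atBot_add_const_right atBot (|τ| + |ε|) tendsto_id)
      have := (abs_le.mp (hbd a)).2
      simp only [id]
      linarith
  intro y
  obtain ⟨b, rfl⟩ := QuotientAddGroup.mk_surjective y
  obtain ⟨a, rfl⟩ := hsurj b
  refine ⟨(a : AddCircle (1:ℝ)), ?_⟩
  have h : sinA (a : AddCircle (1:ℝ)) = Real.sin (2 * π * a) := sin2_periodic.lift_coe a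
  simp only [arnoldMap, h, add_sub_assoc]
  rfl

/-- The Markov operator `f ↦ (x ↦ ∫ f (F_w x) dν(w))` of the noisy circle map. -/
def markovOp (τ ε σ : ℝ) (f : AddCircle (1:ℝ) → ℝ) (x : AddCircle (1:ℝ)) : ℝ :=
  ∫ w, f (Fmap τ ε σ w x) ∂nuI

section MarkovOperator

variable {τ ε σ C : ℝ} {f : AddCircle (1:ℝ) → ℝ}

lemma measurable_comp_Fmap (hf : Measurable f) :
    Measurable fun p : AddCircle (1:ℝ) × ℝ => f (Fmap τ ε σ p.2 p.1) :=
  hf.comp (continuous_uncurry_Fmap τ ε σ).measurable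

lemma measurable_markovOp (hf : Measurable f) : Measurable (markovOp τ ε σ f) :=
  (measurable_comp_Fmap hf).stronglyMeasurable.integral_prod_right'.measurable

lemma abs_markovOp_le (hC : ∀ x, |f x| ≤ C) (x : AddCircle (1:ℝ)) :
    |markovOp τ ε σ f x| ≤ C := by
  simpa [markovOp] using norm_integral_le_of_norm_le_const (μ := nuI)
    (f := fun w => f (Fmap τ ε σ w x)) (Eventually.of_forall fun w => hC _)

lemma integrable_of_abs_le {α : Type*} [MeasurableSpace α] {μ : Measure α} [IsFiniteMeasure μ]
    {g : α → ℝ} {K : ℝ} (hg : Measurable g) (hK : ∀ x, |g x| ≤ K) : Integrable g μ :=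
  Integrable.of_bound hg.aestronglyMeasurable K (Eventually.of_forall hK)

lemma integrable_comp_Fmap (hf : Measurable f) (hC : ∀ x, |f x| ≤ C) (x : AddCircle (1:ℝ)) :
    Integrable (fun w => f (Fmap τ ε σ w x)) nuI :=
  integrable_of_abs_le ((measurable_comp_Fmap hf).comp measurable_prodMk_left) fun _ => hC _

lemma IsStationaryNoisy.map_prod_eq {m : Measure (AddCircle (1:ℝ))} [IsProbabilityMeasure m]
    (hm : IsStationaryNoisy τ ε σ m) :
    (m.prod nuI).map (fun p => Fmap τ ε σ p.2 p.1) = m := by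
  have hF := (continuous_uncurry_Fmap τ ε σ).measurable
  have hmap : ∀ (s : Set (AddCircle (1:ℝ))), MeasurableSet s → ∀ w,
      m.map (Fmap τ ε σ w) s = m ((fun x => (x, w)) ⁻¹'
        ((fun p : AddCircle (1:ℝ) × ℝ => Fmap τ ε σ p.2 p.1) ⁻¹' s)) := fun s hs w =>
    Measure.map_apply (hF.comp measurable_prodMk_right) hs
  have hmeas : Measurable fun w => m.map (Fmap τ ε σ w) := by
    refine Measure.measurable_of_measurable_coe _ fun s hs => ?_
    simp_rw [hmap s hs]
    exact measurable_measure_prodMk_right (hF hs)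
  ext s hs
  conv_rhs => rw [← hm]
  rw [Measure.bind_apply hs hmeas.aemeasurable, Measure.map_apply hF hs,
    Measure.prod_apply_symm (hF hs)]
  simp_rw [hmap s hs]

lemma IsStationaryNoisy.integral_markovOp {m : Measure (AddCircle (1:ℝ))}
    [IsProbabilityMeasure m] (hm : IsStationaryNoisy τ ε σ m) (hf : Measurable f)
    (hC : ∀ x, |f x| ≤ C) : ∫ x, markovOp τ ε σ f x ∂m = ∫ x, f x ∂m := by
  conv_rhs => rw [← hm.map_prod_eq]
  rw [integral_map (continuous_uncurry_Fmap τ ε σ).measurable.aemeasurable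
    hf.aestronglyMeasurable,
    integral_prod _ (integrable_of_abs_le (measurable_comp_Fmap hf) fun _ => hC _)]
  rfl

lemma abs_integral_translate_sub_le (hσ : 0 < σ) (hf : Measurable f) (hC : ∀ x, |f x| ≤ C)
    (y z : AddCircle (1:ℝ)) :
    |(∫ w, f (y + ((σ * w : ℝ) : AddCircle (1:ℝ))) ∂nuI) -
      ∫ w, f (z + ((σ * w : ℝ) : AddCircle (1:ℝ))) ∂nuI| ≤ 2 * C / σ * dist y z := by
  have hC0 : 0 ≤ C := (abs_nonneg _).trans (hC 0)
  have key : ∀ d : ℝ, (d : AddCircle (1:ℝ)) = y - z →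
      |(∫ w, f (y + ((σ * w : ℝ) : AddCircle (1:ℝ))) ∂nuI) -
        ∫ w, f (z + ((σ * w : ℝ) : AddCircle (1:ℝ))) ∂nuI| ≤ 2 * C / σ * |d| := by
    intro d hd
    set H : ℝ → ℝ := fun t => f (z + (t : AddCircle (1:ℝ))) with hH
    have hHm : Measurable H :=
      hf.comp (measurable_const.add continuous_coe_addCircle.measurable)
    have hHi : ∀ a b, IntervalIntegrable H volume a b := fun a b =>
      (intervalIntegrable_const (c := C)).mono_fun hHm.aestronglyMeasurable
        (Eventually.of_forall fun t => by
          simpa [abs_of_nonneg hC0] using hC (z + (t : AddCircle (1:ℝ))))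
    have hint : ∀ c : ℝ, ∫ w, H (c + σ * w) ∂nuI =
        σ⁻¹ * ∫ t in (c + σ * (-(1/2)))..(c + σ * (1/2)), H t := fun c => by
      rw [nuI, integral_Icc_eq_integral_Ioc,
        ← intervalIntegral.integral_of_le (by norm_num : (-(1/2) : ℝ) ≤ 1/2),
        intervalIntegral.integral_comp_add_mul H hσ.ne']
      rfl
    have hy : ∀ w : ℝ, f (y + ((σ * w : ℝ) : AddCircle (1:ℝ))) = H (d + σ * w) := fun w => by
      rw [hH]
      simp only [AddCircle.coe_add, hd]
      congr 1
      abel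
    have hz : ∀ w : ℝ, f (z + ((σ * w : ℝ) : AddCircle (1:ℝ))) = H (0 + σ * w) := fun w => by
      rw [hH, zero_add]
    simp_rw [hy, hz]
    rw [hint, hint, ← mul_sub, intervalIntegral.integral_interval_sub_interval_comm
      (hHi _ _) (hHi _ _) (hHi _ _), abs_mul, abs_of_pos (inv_pos.mpr hσ)]
    have hbd : ∀ a b, |∫ t in a..b, H t| ≤ C * |b - a| := fun a b =>
      intervalIntegral.norm_integral_le_of_norm_le_const (f := H) fun t _ => hC _
    have h1 := hbd (d + σ * (-(1/2))) (0 + σ * (-(1/2)))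
    have h2 := hbd (d + σ * (1/2)) (0 + σ * (1/2))
    rw [show 0 + σ * (-(1/2)) - (d + σ * (-(1/2))) = -d by ring, abs_neg] at h1
    rw [show 0 + σ * (1/2) - (d + σ * (1/2)) = -d by ring, abs_neg] at h2
    calc _ ≤ σ⁻¹ * (C * |d| + C * |d|) :=
          mul_le_mul_of_nonneg_left ((abs_sub _ _).trans (add_le_add h1 h2))
            (inv_pos.mpr hσ).le
      _ = _ := by ring
  have hlim : Tendsto (fun δ : ℝ => 2 * C / σ * (dist y z + δ)) (nhdsWithin 0 (Ioi 0))
      (nhds (2 * C / σ * dist y z)) := by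
    have : Tendsto (fun δ : ℝ => 2 * C / σ * (dist y z + δ)) (nhds 0)
        (nhds (2 * C / σ * (dist y z + 0))) := Continuous.tendsto (by fun_prop) 0
    rw [add_zero] at this
    exact this.mono_left nhdsWithin_le_nhds
  refine ge_of_tendsto hlim ?_
  filter_upwards [self_mem_nhdsWithin] with δ hδ
  obtain ⟨d, hd, hdlt⟩ := QuotientAddGroup.exists_norm_mk_lt (y - z) hδ
  refine (key d hd).trans (mul_le_mul_of_nonneg_left ?_ (by positivity))
  rw [dist_eq_norm]
  exact hdlt.le

lemma abs_markovOp_sub_le (hσ : 0 < σ) (hf : Measurable f) (hC : ∀ x, |f x| ≤ C)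
    (x y : AddCircle (1:ℝ)) :
    |markovOp τ ε σ f x - markovOp τ ε σ f y| ≤
      2 * C / σ * dist (arnoldMap τ ε x) (arnoldMap τ ε y) := by
  simpa only [markovOp, Fmap_eq_arnoldMap_add] using
    abs_integral_translate_sub_le hσ hf hC (arnoldMap τ ε x) (arnoldMap τ ε y)

lemma continuous_markovOp (hσ : 0 < σ) (hf : Measurable f) (hC : ∀ x, |f x| ≤ C) :
    Continuous (markovOp τ ε σ f) := by
  refine continuous_iff_continuousAt.mpr fun x => ?_
  have h : Tendsto (fun y => 2 * C / σ * dist (arnoldMap τ ε y) (arnoldMap τ ε x)) (nhds x)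
      (nhds (2 * C / σ * dist (arnoldMap τ ε x) (arnoldMap τ ε x))) :=
    Continuous.tendsto (by have := continuous_arnoldMap τ ε; fun_prop) x
  rw [dist_self, mul_zero] at h
  exact tendsto_iff_dist_tendsto_zero.mpr
    (squeeze_zero (fun _ => dist_nonneg) (fun y => abs_markovOp_sub_le hσ hf hC y x) h)

lemma equicontinuous_markovOp (hσ : 0 < σ) {ι : Type*} {g : ι → AddCircle (1:ℝ) → ℝ}
    (hg : ∀ i, Measurable (g i)) (hC : ∀ i x, |g i x| ≤ C) :
    Equicontinuous fun i => markovOp τ ε σ (g i) := by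
  refine fun x => Metric.equicontinuousAt_of_continuity_modulus
    (fun y => 2 * C / σ * dist (arnoldMap τ ε x) (arnoldMap τ ε y)) ?_ _
    (Eventually.of_forall fun y i => abs_markovOp_sub_le hσ (hg i) (hC i) x y)
  have h : Tendsto (fun y => 2 * C / σ * dist (arnoldMap τ ε x) (arnoldMap τ ε y)) (nhds x)
      (nhds (2 * C / σ * dist (arnoldMap τ ε x) (arnoldMap τ ε x))) :=
    Continuous.tendsto (by have := continuous_arnoldMap τ ε; fun_prop) x
  rwa [dist_self, mul_zero] at h

lemma measurable_iterate_markovOp (hf : Measurable f) (n : ℕ) :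
    Measurable ((markovOp τ ε σ)^[n] f) := by
  induction n with
  | zero => exact hf
  | succ n ih => rw [iterate_succ_apply']; exact measurable_markovOp ih

lemma abs_iterate_markovOp_le (hC : ∀ x, |f x| ≤ C) (n : ℕ) :
    ∀ x, |(markovOp τ ε σ)^[n] f x| ≤ C := by
  induction n with
  | zero => exact hC
  | succ n ih => rw [iterate_succ_apply']; exact abs_markovOp_le ih

lemma IsStationaryNoisy.integral_iterate_markovOp {m : Measure (AddCircle (1:ℝ))}
    [IsProbabilityMeasure m] (hm : IsStationaryNoisy τ ε σ m) (hf : Measurable f)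
    (hC : ∀ x, |f x| ≤ C) (n : ℕ) :
    ∫ x, (markovOp τ ε σ)^[n] f x ∂m = ∫ x, f x ∂m := by
  induction n with
  | zero => rfl
  | succ n ih =>
    rw [iterate_succ_apply', hm.integral_markovOp (measurable_iterate_markovOp hf n)
      (abs_iterate_markovOp_le hC n), ih]

end MarkovOperator

section Rigidity

variable {τ ε σ C : ℝ} {f : AddCircle (1:ℝ) → ℝ}

lemma abs_sq_le_sq_of_abs_le {a K : ℝ} (h : |a| ≤ K) : |a ^ 2| ≤ K ^ 2 := by
  rw [abs_pow]
  exact pow_le_pow_left₀ (abs_nonneg a) h 2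

lemma markovOp_sq_sub_sq (hf : Measurable f) (hC : ∀ x, |f x| ≤ C) (x : AddCircle (1:ℝ)) :
    markovOp τ ε σ (fun y => f y ^ 2) x - markovOp τ ε σ f x ^ 2 =
      ∫ w, (f (Fmap τ ε σ w x) - markovOp τ ε σ f x) ^ 2 ∂nuI := by
  have h1 : Integrable (fun w => f (Fmap τ ε σ w x)) nuI := integrable_comp_Fmap hf hC x
  have h2 : Integrable (fun w => f (Fmap τ ε σ w x) ^ 2) nuI :=
    integrable_comp_Fmap (hf.pow_const 2) (fun y => abs_sq_le_sq_of_abs_le (hC y)) x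
  set c := markovOp τ ε σ f x with hc
  have h3 : ∀ w, (f (Fmap τ ε σ w x) - c) ^ 2 =
      f (Fmap τ ε σ w x) ^ 2 - 2 * c * f (Fmap τ ε σ w x) + c ^ 2 := fun w => by ring
  simp_rw [h3]
  have h4 : Integrable (fun w => f (Fmap τ ε σ w x) ^ 2 - 2 * c * f (Fmap τ ε σ w x)) nuI :=
    h2.sub (h1.const_mul _)
  rw [integral_add h4 (integrable_const _), integral_sub h2 (h1.const_mul _),
    integral_const_mul, integral_const]
  change _ = markovOp τ ε σ (fun y => f y ^ 2) x - 2 * c * markovOp τ ε σ f x + _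
  rw [← hc]
  simp
  ring

lemma sq_markovOp_le (hf : Measurable f) (hC : ∀ x, |f x| ≤ C) (x : AddCircle (1:ℝ)) :
    markovOp τ ε σ f x ^ 2 ≤ markovOp τ ε σ (fun y => f y ^ 2) x := by
  rw [← sub_nonneg, markovOp_sq_sub_sq hf hC]
  exact integral_nonneg fun w => sq_nonneg _

lemma IsStationaryNoisy.integral_sq_markovOp_le {m : Measure (AddCircle (1:ℝ))}
    [IsProbabilityMeasure m] (hm : IsStationaryNoisy τ ε σ m) (hf : Measurable f)
    (hC : ∀ x, |f x| ≤ C) : ∫ x, markovOp τ ε σ f x ^ 2 ∂m ≤ ∫ x, f x ^ 2 ∂m := by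
  have hC2 : ∀ x, |f x ^ 2| ≤ C ^ 2 := fun x => abs_sq_le_sq_of_abs_le (hC x)
  rw [← hm.integral_markovOp (hf.pow_const 2) hC2]
  exact integral_mono
    (integrable_of_abs_le ((measurable_markovOp hf).pow_const 2)
      fun x => abs_sq_le_sq_of_abs_le (abs_markovOp_le hC x))
    (integrable_of_abs_le (measurable_markovOp (hf.pow_const 2)) (abs_markovOp_le hC2))
    (sq_markovOp_le hf hC)

lemma eq_of_locally_constant_on_arcs {r : ℝ} (hr : 0 < r) {Y : Type*}
    {h : AddCircle (1:ℝ) → Y}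
    (hloc : ∀ y, ∀ t : ℝ, |t| ≤ r → h (y + (t : AddCircle (1:ℝ))) = h y)
    (x y : AddCircle (1:ℝ)) : h x = h y := by
  refine IsLocallyConstant.apply_eq_of_preconnectedSpace
    ((IsLocallyConstant.iff_eventually_eq h).mpr fun x => ?_) x y
  filter_upwards [Metric.ball_mem_nhds x hr] with z hz
  rw [Metric.mem_ball, dist_eq_norm, QuotientAddGroup.norm_lt_iff] at hz
  obtain ⟨t, ht, htr⟩ := hz
  rw [← hloc x t htr.le]
  congr 1
  exact eq_add_of_sub_eq' ht.symm

lemma isOpenPosMeasure_of_measSupport_eq_univ {m : Measure (AddCircle (1:ℝ))}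
    (hsupp : measSupport m = Set.univ) : m.IsOpenPosMeasure := by
  refine ⟨fun U hU ⟨x, hx⟩ => ?_⟩
  have : x ∈ measSupport m := hsupp ▸ mem_univ x
  exact (this U hU hx).ne'

/-- If `h` is continuous and the Markov operator preserves its `L²` norm with respect to a
stationary measure of full support, then `h` is constant. -/
lemma IsStationaryNoisy.eq_of_integral_sq_markovOp_eq {m : Measure (AddCircle (1:ℝ))}
    [IsProbabilityMeasure m] (hm : IsStationaryNoisy τ ε σ m) (hσ : 0 < σ)
    (hsupp : measSupport m = Set.univ) {h : AddCircle (1:ℝ) → ℝ} (hh : Continuous h)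
    (hC : ∀ x, |h x| ≤ C)
    (heq : ∫ x, markovOp τ ε σ h x ^ 2 ∂m = ∫ x, h x ^ 2 ∂m) (x y : AddCircle (1:ℝ)) :
    h x = h y := by
  have := isOpenPosMeasure_of_measSupport_eq_univ hsupp
  have hhm : Measurable h := hh.measurable
  have hC2 : ∀ x, |h x ^ 2| ≤ C ^ 2 := fun x => abs_sq_le_sq_of_abs_le (hC x)
  have hc1 : Continuous (markovOp τ ε σ h) := continuous_markovOp hσ hhm hC
  have hc2 : Continuous (markovOp τ ε σ fun y => h y ^ 2) :=
    continuous_markovOp hσ (hhm.pow_const 2) hC2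
  have hi1 : Integrable (fun x => markovOp τ ε σ h x ^ 2) m :=
    integrable_of_abs_le (hc1.measurable.pow_const 2)
      fun x => abs_sq_le_sq_of_abs_le (abs_markovOp_le hC x)
  have hi2 : Integrable (markovOp τ ε σ fun y => h y ^ 2) m :=
    integrable_of_abs_le hc2.measurable (abs_markovOp_le hC2)
  have hzero : (fun x => markovOp τ ε σ (fun y => h y ^ 2) x - markovOp τ ε σ h x ^ 2) = 0 := by
    refine (Continuous.ae_eq_iff_eq m (hc2.sub (hc1.pow 2)) continuous_zero).mp ?_
    refine (integral_eq_zero_iff_of_nonneg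
      (fun x => sub_nonneg.mpr (sq_markovOp_le hhm hC x)) (hi2.sub hi1)).mp ?_
    rw [integral_sub hi2 hi1, heq, hm.integral_markovOp (hhm.pow_const 2) hC2, sub_self]
  have harc : ∀ x, ∀ w ∈ Icc (-(1/2) : ℝ) (1/2),
      h (Fmap τ ε σ w x) = markovOp τ ε σ h x := by
    intro x
    have hcF : Continuous fun w => h (Fmap τ ε σ w x) :=
      hh.comp ((continuous_uncurry_Fmap τ ε σ).comp (Continuous.prodMk_right x))
    have h0 := congrFun hzero x
    simp only [Pi.zero_apply] at h0
    rw [markovOp_sq_sub_sq hhm hC, integral_eq_zero_iff_of_nonneg (fun w => sq_nonneg _)] at h0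
    · refine Measure.eqOn_Icc_of_ae_eq volume (by norm_num) ?_ hcF.continuousOn
        continuousOn_const
      change _ =ᵐ[nuI] _
      filter_upwards [h0] with w hw
      exact sub_eq_zero.mp (pow_eq_zero_iff two_ne_zero |>.mp hw)
    · refine integrable_of_abs_le (K := (C + C) ^ 2)
        ((hcF.measurable.sub_const _).pow_const 2) fun w => abs_sq_le_sq_of_abs_le ?_
      exact (abs_sub _ _).trans (add_le_add (hC _) (abs_markovOp_le hC x))
  refine eq_of_locally_constant_on_arcs (half_pos hσ) (fun z t ht => ?_) x y
  obtain ⟨x, rfl⟩ := surjective_arnoldMap τ ε z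
  have ht' := abs_le.mp ht
  have h1 := harc x (t / σ) ⟨by rw [le_div_iff₀ hσ]; linarith, by rw [div_le_iff₀ hσ]; linarith⟩
  have h2 := harc x 0 ⟨by norm_num, by norm_num⟩
  rw [Fmap_eq_arnoldMap_add, mul_div_cancel₀ _ hσ.ne'] at h1
  rw [Fmap_eq_arnoldMap_add, mul_zero, AddCircle.coe_zero, add_zero] at h2
  rw [h1, h2]

/-- Iterates of the Markov operator converge pointwise to the mean with respect to a
stationary measure of full support. -/
lemma IsStationaryNoisy.tendsto_iterate_markovOp {m : Measure (AddCircle (1:ℝ))}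
    [IsProbabilityMeasure m] (hm : IsStationaryNoisy τ ε σ m) (hσ : 0 < σ)
    (hsupp : measSupport m = Set.univ) (hf : Measurable f) (hC : ∀ x, |f x| ≤ C)
    (x₀ : AddCircle (1:ℝ)) :
    Tendsto (fun n => (markovOp τ ε σ)^[n] f x₀) atTop (nhds (∫ x, f x ∂m)) := by
  set u : ℕ → AddCircle (1:ℝ) → ℝ := fun n => (markovOp τ ε σ)^[n] f with hu
  have hum : ∀ n, Measurable (u n) := measurable_iterate_markovOp hf
  have huC : ∀ n x, |u n x| ≤ C := abs_iterate_markovOp_le hC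
  have husucc : ∀ n, u (n + 1) = markovOp τ ε σ (u n) := fun n => iterate_succ_apply' _ n f
  obtain ⟨L, hL⟩ : ∃ L, Tendsto (fun n => ∫ x, u n x ^ 2 ∂m) atTop (nhds L) := by
    refine ⟨_, tendsto_atTop_ciInf (antitone_nat_of_succ_le fun n => ?_) ⟨0, ?_⟩⟩
    · rw [husucc]
      exact hm.integral_sq_markovOp_le (hum n) (huC n)
    · rintro _ ⟨n, rfl⟩
      exact integral_nonneg fun x => sq_nonneg _
  let U : ℕ → BoundedContinuousFunction (AddCircle (1:ℝ)) ℝ := fun n =>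
    BoundedContinuousFunction.mkOfCompact
      ⟨u (n + 1), husucc n ▸ continuous_markovOp hσ (hum n) (huC n)⟩
  have hcomp : IsCompact (closure (range U)) := by
    refine BoundedContinuousFunction.arzela_ascoli (Icc (-C) C) isCompact_Icc _ ?_ ?_
    · rintro _ x ⟨n, rfl⟩
      exact abs_le.mp (huC (n + 1) x)
    · choose k hk using fun g : range U => g.2
      have := equicontinuous_markovOp (τ := τ) (ε := ε) hσ (g := fun g => u (k g))
        (fun g => hum _) (fun g => huC _)
      convert this using 2 with g
      rw [← hk g, ← husucc]
      rfl
  refine (tendsto_add_atTop_iff_nat 1).mp (tendsto_of_subseq_tendsto fun ns hns => ?_)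
  obtain ⟨h, -, ms, hms, hlim⟩ :=
    hcomp.tendsto_subseq (x := fun n => U (ns n)) fun n => subset_closure (mem_range_self _)
  have hk : Tendsto (fun n => ns (ms n)) atTop atTop := hns.comp hms.tendsto_atTop
  have hpt : ∀ x, Tendsto (fun n => u (ns (ms n) + 1) x) atTop (nhds (h x)) := fun x =>
    ((BoundedContinuousFunction.lipschitz_eval_const x).continuous.tendsto h).comp hlim
  have hhC : ∀ x, |h x| ≤ C := fun x =>
    le_of_tendsto (hpt x).abs (Eventually.of_forall fun n => huC _ x)
  have hdct : ∀ (g : ℕ → AddCircle (1:ℝ) → ℝ) (g' : AddCircle (1:ℝ) → ℝ) (K : ℝ),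
      (∀ n, Measurable (g n)) → (∀ n x, |g n x| ≤ K) →
      (∀ x, Tendsto (fun n => g n x) atTop (nhds (g' x))) →
      Tendsto (fun n => ∫ x, g n x ∂m) atTop (nhds (∫ x, g' x ∂m)) := fun g g' K h1 h2 h3 =>
    tendsto_integral_of_dominated_convergence (fun _ => K)
      (fun n => (h1 n).aestronglyMeasurable) (integrable_const K)
      (fun n => Eventually.of_forall (h2 n)) (Eventually.of_forall h3)
  have hpt' : ∀ x, Tendsto (fun n => u (ns (ms n) + 1 + 1) x) atTop
      (nhds (markovOp τ ε σ h x)) := fun x => by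
    simp_rw [husucc (ns (ms _) + 1)]
    exact tendsto_integral_of_dominated_convergence (fun _ => C)
      (fun n => (integrable_comp_Fmap (hum _) (huC _) x).aestronglyMeasurable)
      (integrable_const C) (fun n => Eventually.of_forall fun w => huC _ _)
      (Eventually.of_forall fun w => hpt _)
  have hsq : ∫ x, h x ^ 2 ∂m = L := tendsto_nhds_unique
    (hdct (fun n x => u (ns (ms n) + 1) x ^ 2) _ (C ^ 2) (fun n => (hum _).pow_const 2)
      (fun n x => abs_sq_le_sq_of_abs_le (huC _ x)) fun x => (hpt x).pow 2)
    (hL.comp ((tendsto_add_atTop_nat 1).comp hk))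
  have hsq' : ∫ x, markovOp τ ε σ h x ^ 2 ∂m = L := tendsto_nhds_unique
    (hdct (fun n x => u (ns (ms n) + 1 + 1) x ^ 2) _ (C ^ 2) (fun n => (hum _).pow_const 2)
      (fun n x => abs_sq_le_sq_of_abs_le (huC _ x)) fun x => (hpt' x).pow 2)
    (hL.comp ((tendsto_add_atTop_nat 2).comp hk))
  have hconst := hm.eq_of_integral_sq_markovOp_eq hσ hsupp h.continuous hhC
    (hsq'.trans hsq.symm)
  have hmean : ∫ x, h x ∂m = ∫ x, f x ∂m := by
    refine tendsto_nhds_unique (hdct (fun n => u (ns (ms n) + 1)) _ C (fun n => hum _)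
      (fun n => huC _) hpt) ?_
    simp_rw [hu, hm.integral_iterate_markovOp hf hC]
    exact tendsto_const_nhds
  refine ⟨ms, ?_⟩
  rw [← hmean, integral_congr_ae (Eventually.of_forall fun x => hconst x x₀)]
  simp only [integral_const, probReal_univ, one_smul]
  exact hpt x₀

end Rigidity

section RandomIterates

variable {τ ε σ C : ℝ} {P : Measure (ℤ → ℝ)}

lemma measurable_phiN (n : ℕ) (x₀ : AddCircle (1:ℝ)) :
    Measurable fun ω => phiN τ ε σ ω n x₀ := by
  induction n with
  | zero => exact measurable_const
  | succ n ih =>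
    exact (continuous_uncurry_Fmap τ ε σ).measurable.comp (ih.prodMk (measurable_pi_apply _))

lemma phiN_congr {ω ω' : ℤ → ℝ} {n : ℕ} (h : ∀ k < n, ω k = ω' k) (x₀ : AddCircle (1:ℝ)) :
    phiN τ ε σ ω n x₀ = phiN τ ε σ ω' n x₀ := by
  induction n with
  | zero => rfl
  | succ n ih =>
    simp only [phiN, comp_apply]
    rw [ih fun k hk => h k (hk.trans n.lt_succ_self), h n n.lt_succ_self]

lemma IsProductNuZ.eq_infinitePi (hP : IsProductNuZ P) :
    P = Measure.infinitePi fun _ : ℤ => nuI :=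
  IsProjectiveLimit.unique (α := fun _ : ℤ => ℝ)
    (P := fun s : Finset ℤ => Measure.pi fun _ : s => nuI)
    (fun s => hP.2 s) (Measure.isProjectiveLimit_infinitePi _)

lemma IsProductNuZ.map_eval (hP : IsProductNuZ P) (i : ℤ) : P.map (fun ω => ω i) = nuI := by
  rw [hP.eq_infinitePi]
  exact Measure.infinitePi_map_eval _ i

lemma IsProductNuZ.indepFun_phiN (hP : IsProductNuZ P) (n : ℕ) (x₀ : AddCircle (1:ℝ)) :
    ProbabilityTheory.IndepFun (fun ω => phiN τ ε σ ω n x₀) (fun ω => ω n) P := by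
  have hi : ProbabilityTheory.iIndepFun (fun (i : ℤ) (ω : ℤ → ℝ) => ω i) P := by
    rw [hP.eq_infinitePi]
    exact ProbabilityTheory.iIndepFun_infinitePi (X := fun _ => id) fun _ => measurable_id
  let S : Finset ℤ := Finset.Ico 0 n
  have hind := hi.indepFun_finset S {(n : ℤ)} (by simp [S]) fun i => measurable_pi_apply i
  let ext : (S → ℝ) → ℤ → ℝ := fun v i => if h : i ∈ S then v ⟨i, h⟩ else 0
  have hext : Measurable ext := measurable_pi_lambda _ fun i => by
    by_cases h : i ∈ S
    · simpa only [ext, h, dite_true] using measurable_pi_apply _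
    · simpa only [ext, h, dite_false] using measurable_const
  have heval : Measurable fun v : ({(n : ℤ)} : Finset ℤ) → ℝ =>
      v ⟨(n : ℤ), Finset.mem_singleton_self _⟩ := measurable_pi_apply _
  have hcomp := hind.comp (φ := fun v => phiN τ ε σ (ext v) n x₀)
    ((measurable_phiN n x₀).comp hext) heval
  convert hcomp using 1
  · funext ω
    refine phiN_congr (fun k hk => ?_) x₀
    have hkS : (k : ℤ) ∈ S := by simp [S, hk]
    simp [ext, hkS]
  · rfl

lemma IsProductNuZ.integral_comp_phiN (hP : IsProductNuZ P) (x₀ : AddCircle (1:ℝ)) (n : ℕ) :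
    ∀ {f : AddCircle (1:ℝ) → ℝ}, Measurable f → (∀ x, |f x| ≤ C) →
      ∫ ω, f (phiN τ ε σ ω n x₀) ∂P = (markovOp τ ε σ)^[n] f x₀ := by
  have := hP.1
  induction n with
  | zero => intro f hf hC; simp [phiN]
  | succ n ih =>
    intro f hf hC
    rw [iterate_succ_apply, ← ih (measurable_markovOp hf) (abs_markovOp_le hC)]
    have hφ := measurable_phiN (τ := τ) (ε := ε) (σ := σ) n x₀
    have hn : Measurable fun ω : ℤ → ℝ => ω n := measurable_pi_apply _
    have hprod := (ProbabilityTheory.indepFun_iff_map_prod_eq_prod_map_map hφ.aemeasurable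
      hn.aemeasurable).mp (hP.indepFun_phiN n x₀)
    rw [hP.map_eval] at hprod
    have hg : Measurable fun p : AddCircle (1:ℝ) × ℝ => f (Fmap τ ε σ p.2 p.1) :=
      measurable_comp_Fmap hf
    have := Measure.isProbabilityMeasure_map (μ := P) hφ.aemeasurable
    calc ∫ ω, f (phiN τ ε σ ω (n + 1) x₀) ∂P
        = ∫ p, f (Fmap τ ε σ p.2 p.1) ∂(P.map fun ω => (phiN τ ε σ ω n x₀, ω n)) :=
          (integral_map (hφ.prodMk hn).aemeasurable hg.aestronglyMeasurable).symm
      _ = ∫ x, markovOp τ ε σ f x ∂(P.map fun ω => phiN τ ε σ ω n x₀) := by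
          rw [hprod, integral_prod _ (integrable_of_abs_le hg fun _ => hC _)]
          rfl
      _ = _ := integral_map hφ.aemeasurable (measurable_markovOp hf).aestronglyMeasurable

end RandomIterates

/-- **Mixing when the support is the whole circle:** if the support of the (unique)
stationary measure `m` is all of `ℝ/ℤ`, then for every bounded Borel function `f` and
every initial point `x₀`, `E[f(φ(n,·)(x₀))] → ∫ f dm` as `n → ∞`. -/
theorem noisy_circle_map_mixing (τ ε σ : ℝ)
    (hε : 0 < ε) (hεπ : 2 * π * ε < 1) (hσ : 0 < σ)
    (P : Measure (ℤ → ℝ)) (hP : IsProductNuZ P)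
    (m : Measure (AddCircle (1:ℝ)))
    (hprob : IsProbabilityMeasure m) (hstat : IsStationaryNoisy τ ε σ m)
    (hsupp : measSupport m = Set.univ) :
    ∀ f : AddCircle (1:ℝ) → ℝ, Measurable f → (∃ C, ∀ x, |f x| ≤ C) →
      ∀ x₀ : AddCircle (1:ℝ),
        Tendsto (fun n : ℕ => ∫ ω, f (phiN τ ε σ ω n x₀) ∂P) atTop
          (nhds (∫ x, f x ∂m)) := by
  rintro f hf ⟨C, hC⟩ x₀
  simp_rw [hP.integral_comp_phiN x₀ _ hf hC]
  exact hstat.tendsto_iterate_markovOp hσ hsupp hf hC x₀
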